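/- For every finite bipartite graph G=(A,B,E): |ker_A(G)| + |diadem_B(G)| = |ker_B(G)| + |diadem_A(G)| = α(G), and moreover diadem_A(G) ∪ diadem_B(G) = diadem(G). -/

import Mathlib

open Finset

open scoped Classical

variable {V : Type*} [Fintype V] [DecidableEq V]

/-- The neighborhood `N(X)` of a finite set of vertices `X`. -/
noncomputable def nbr (G : SimpleGraph V) (X : Finset V) : Finset V :=
  Finset.univ.filter fun v => ∃ x ∈ X, G.Adj v x

/-- The difference `d(X) = |X| - |N(X)|` of a set of vertices. -/
noncomputable def diffZ (G : SimpleGraph V) (X : Finset V) : ℤ :=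
  (X.card : ℤ) - ((nbr G X).card : ℤ)

/-- The critical difference `d_c(G) = max {d(X) : X ⊆ V}`. -/
noncomputable def critDiff (G : SimpleGraph V) : ℤ :=
  (Finset.univ : Finset V).powerset.sup' (Finset.powerset_nonempty _) (diffZ G)

/-- A set of vertices is independent if no two of its vertices are adjacent. -/
def IsIndep (G : SimpleGraph V) (S : Finset V) : Prop :=
  ∀ u ∈ S, ∀ v ∈ S, ¬ G.Adj u v

/-- The independence number `α(G)`. -/
noncomputable def indepNum (G : SimpleGraph V) : ℕ :=
  ((Finset.univ : Finset V).powerset.filter (IsIndep G)).sup Finset.card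

/-- The critical independence difference `id_c(G) = max {d(I) : I independent}`. -/
noncomputable def idc (G : SimpleGraph V) : ℤ :=
  ((Finset.univ : Finset V).powerset.filter (IsIndep G)).sup'
    ⟨∅, by simp [IsIndep]⟩ (diffZ G)

/-- A critical independent set: an independent set `S` with `d(S) = id_c(G)`. -/
def CritIndep (G : SimpleGraph V) (S : Finset V) : Prop :=
  IsIndep G S ∧ diffZ G S = idc G

/-- A finite set of edges of `G` that are pairwise non-incident (a matching). -/
def IsMatchingSet (G : SimpleGraph V) (M : Finset (Sym2 V)) : Prop :=
  (∀ e ∈ M, e ∈ G.edgeSet) ∧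
    (M : Set (Sym2 V)).Pairwise fun e f => ∀ v : V, ¬(v ∈ e ∧ v ∈ f)

/-- The matching number `μ(G)`. -/
noncomputable def matchNum (G : SimpleGraph V) : ℕ :=
  ((Finset.univ : Finset (Sym2 V)).powerset.filter (IsMatchingSet G)).sup Finset.card

/-- A maximum independent set. -/
def IsMaxIndep (G : SimpleGraph V) (S : Finset V) : Prop :=
  IsIndep G S ∧ S.card = indepNum G

/-- `ker(G)`: the intersection of all critical independent sets. -/
noncomputable def kerSet (G : SimpleGraph V) : Finset V :=
  Finset.univ.filter fun v => ∀ S : Finset V, CritIndep G S → v ∈ S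

/-- `diadem(G)`: the union of all critical independent sets. -/
noncomputable def diademSet (G : SimpleGraph V) : Finset V :=
  Finset.univ.filter fun v => ∃ S : Finset V, CritIndep G S ∧ v ∈ S

/-- `core(G)`: the intersection of all maximum independent sets. -/
noncomputable def coreSet (G : SimpleGraph V) : Finset V :=
  Finset.univ.filter fun v => ∀ S : Finset V, IsMaxIndep G S → v ∈ S

/-- `corona(G)`: the union of all maximum independent sets. -/
noncomputable def coronaSet (G : SimpleGraph V) : Finset V :=
  Finset.univ.filter fun v => ∃ S : Finset V, IsMaxIndep G S ∧ v ∈ S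

/-- `δ₀(A) = max {δ(X) : X ⊆ A}`, the maximum deficiency over subsets of a side. -/
noncomputable def delta0 (G : SimpleGraph V) (A : Finset V) : ℤ :=
  A.powerset.sup' (Finset.powerset_nonempty _) (diffZ G)

/-- An `A`-critical set: a subset `X ⊆ A` with `δ(X) = δ₀(A)`. -/
def SideCrit (G : SimpleGraph V) (A X : Finset V) : Prop :=
  X ⊆ A ∧ diffZ G X = delta0 G A

/-- `ker_A(G)`: the intersection of all `A`-critical sets. -/
noncomputable def kerSide (G : SimpleGraph V) (A : Finset V) : Finset V :=
  Finset.univ.filter fun v => ∀ X : Finset V, SideCrit G A X → v ∈ X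

/-- `diadem_A(G)`: the union of all `A`-critical sets. -/
noncomputable def diademSide (G : SimpleGraph V) (A : Finset V) : Finset V :=
  Finset.univ.filter fun v => ∃ X : Finset V, SideCrit G A X ∧ v ∈ X

/-- `{A, B}` is a bipartition of `G`: both sides nonempty, disjoint, covering all
vertices, and every edge goes between `A` and `B`. -/
def IsBipartition (G : SimpleGraph V) (A B : Finset V) : Prop :=
  A.Nonempty ∧ B.Nonempty ∧ Disjoint A B ∧ A ∪ B = Finset.univ ∧
    ∀ u v : V, G.Adj u v → (u ∈ A ∧ v ∈ B) ∨ (u ∈ B ∧ v ∈ A)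

section Neighborhoods

variable {G : SimpleGraph V} {X Y : Finset V}

lemma mem_nbr {v : V} : v ∈ nbr G X ↔ ∃ x ∈ X, G.Adj v x := by
  simp [nbr]

lemma nbr_inter_subset : nbr G (X ∩ Y) ⊆ nbr G X ∩ nbr G Y := by
  intro v
  simp only [mem_inter, mem_nbr]
  rintro ⟨x, ⟨hX, hY⟩, h⟩
  exact ⟨⟨x, hX, h⟩, ⟨x, hY, h⟩⟩

lemma nbr_union : nbr G (X ∪ Y) = nbr G X ∪ nbr G Y := by
  ext v
  simp only [mem_union, mem_nbr, or_and_right, exists_or]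

lemma nbr_sdiff_nbr_subset : nbr G (X \ nbr G Y) ⊆ nbr G X \ Y := by
  intro v
  simp only [mem_sdiff, mem_nbr]
  rintro ⟨x, ⟨hX, hY⟩, h⟩
  exact ⟨⟨x, hX, h⟩, fun hv => hY ⟨v, hv, h.symm⟩⟩

/-- The difference function is supermodular. -/
lemma diffZ_add_le : diffZ G X + diffZ G Y ≤ diffZ G (X ∩ Y) + diffZ G (X ∪ Y) := by
  have h₁ := card_le_card (nbr_inter_subset (G := G) (X := X) (Y := Y))
  have h₂ := card_union_add_card_inter X Y
  have h₃ := card_union_add_card_inter (nbr G X) (nbr G Y)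
  simp only [diffZ, nbr_union]
  omega

/-- Removing from each of two sets the neighborhood of the other does not decrease the
total difference. -/
lemma diffZ_add_le_sdiff_nbr :
    diffZ G X + diffZ G Y ≤ diffZ G (X \ nbr G Y) + diffZ G (Y \ nbr G X) := by
  have h₁ := card_le_card (nbr_sdiff_nbr_subset (G := G) (X := X) (Y := Y))
  have h₂ := card_le_card (nbr_sdiff_nbr_subset (G := G) (X := Y) (Y := X))
  have h₃ := card_sdiff_add_card_inter X (nbr G Y)
  have h₄ := card_sdiff_add_card_inter Y (nbr G X)
  have h₅ := card_sdiff_add_card_inter (nbr G X) Y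
  have h₆ := card_sdiff_add_card_inter (nbr G Y) X
  rw [inter_comm] at h₅ h₆
  simp only [diffZ]
  omega

end Neighborhoods

section SideCritical

variable {G : SimpleGraph V} {A B X Y : Finset V}

lemma diffZ_le_delta0 (hX : X ⊆ A) : diffZ G X ≤ delta0 G A :=
  le_sup' (diffZ G) (mem_powerset.2 hX)

lemma exists_sideCrit (G : SimpleGraph V) (A : Finset V) : ∃ X, SideCrit G A X := by
  obtain ⟨X, hX, h⟩ := exists_mem_eq_sup' (powerset_nonempty A) (diffZ G)
  exact ⟨X, mem_powerset.1 hX, h.symm⟩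

lemma SideCrit.inter (hX : SideCrit G A X) (hY : SideCrit G A Y) :
    SideCrit G A (X ∩ Y) := by
  have hsub : X ∩ Y ⊆ A := inter_subset_left.trans hX.1
  refine ⟨hsub, le_antisymm (diffZ_le_delta0 hsub) ?_⟩
  have h₁ := diffZ_le_delta0 (G := G) (union_subset hX.1 hY.1)
  have h₂ := diffZ_add_le (G := G) (X := X) (Y := Y)
  have h₃ := hX.2
  have h₄ := hY.2
  linarith

lemma SideCrit.sdiff_nbr (hX : SideCrit G A X) (hY : SideCrit G B Y) :
    SideCrit G A (X \ nbr G Y) := by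
  have hsub : X \ nbr G Y ⊆ A := sdiff_subset.trans hX.1
  refine ⟨hsub, le_antisymm (diffZ_le_delta0 hsub) ?_⟩
  have h₁ := diffZ_le_delta0 (G := G) ((sdiff_subset (s := Y) (t := nbr G X)).trans hY.1)
  have h₂ := diffZ_add_le_sdiff_nbr (G := G) (X := X) (Y := Y)
  have h₃ := hX.2
  have h₄ := hY.2
  linarith

lemma kerSide_subset (hX : SideCrit G A X) : kerSide G A ⊆ X := fun _ hv =>
  (mem_filter.1 hv).2 X hX

lemma sideCrit_kerSide (G : SimpleGraph V) (A : Finset V) :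
    SideCrit G A (kerSide G A) := by
  obtain ⟨X₀, hX₀⟩ := exists_sideCrit G A
  obtain ⟨M, hM, hmin⟩ := exists_min_image (univ.filter (SideCrit G A)) card
    ⟨X₀, by simpa using hX₀⟩
  simp only [mem_filter, mem_univ, true_and] at hM hmin
  have hker : kerSide G A = M := by
    refine (kerSide_subset hM).antisymm fun v hv => mem_filter.2 ⟨mem_univ v, fun X hX => ?_⟩
    have h := eq_of_subset_of_card_le inter_subset_left (hmin _ (hM.inter hX))
    rw [← h] at hv
    exact (mem_inter.1 hv).2
  rwa [hker]

end SideCritical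

section Bipartite

variable {G : SimpleGraph V} {A B X Y S : Finset V}

lemma IsBipartition.symm (h : IsBipartition G A B) : IsBipartition G B A :=
  ⟨h.2.1, h.1, h.2.2.1.symm, by rw [union_comm, h.2.2.2.1],
    fun u v huv => (h.2.2.2.2 u v huv).symm⟩

lemma IsBipartition.nbr_subset (h : IsBipartition G A B) (hX : X ⊆ A) : nbr G X ⊆ B := by
  intro v hv
  obtain ⟨x, hx, hadj⟩ := mem_nbr.1 hv
  rcases h.2.2.2.2 v x hadj with h' | h'
  · exact absurd h'.2 (disjoint_left.1 h.2.2.1 (hX hx))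
  · exact h'.1

lemma IsBipartition.not_adj (h : IsBipartition G A B) {u v : V} (hu : u ∈ A) (hv : v ∈ A) :
    ¬ G.Adj u v := fun hadj =>
  disjoint_left.1 h.2.2.1 hu
    (h.nbr_subset (singleton_subset_iff.2 hv) (mem_nbr.2 ⟨v, mem_singleton_self v, hadj⟩))

lemma IsBipartition.isIndep_union (h : IsBipartition G A B) (hX : X ⊆ A) (hY : Y ⊆ B)
    (hXY : Disjoint Y (nbr G X)) : IsIndep G (X ∪ Y) := by
  intro u hu v hv hadj
  rcases mem_union.1 hu with hu | hu <;> rcases mem_union.1 hv with hv | hv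
  · exact h.not_adj (hX hu) (hX hv) hadj
  · exact disjoint_left.1 hXY hv (mem_nbr.2 ⟨u, hu, hadj.symm⟩)
  · exact disjoint_left.1 hXY hu (mem_nbr.2 ⟨v, hv, hadj⟩)
  · exact h.symm.not_adj (hY hu) (hY hv) hadj

lemma IsBipartition.diffZ_union (h : IsBipartition G A B) (hX : X ⊆ A) (hY : Y ⊆ B) :
    diffZ G (X ∪ Y) = diffZ G X + diffZ G Y := by
  have h₁ := card_union_of_disjoint (disjoint_of_subset_left hX
    (disjoint_of_subset_right hY h.2.2.1))
  have h₂ := card_union_of_disjoint (disjoint_of_subset_left (h.nbr_subset hX)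
    (disjoint_of_subset_right (h.symm.nbr_subset hY) h.2.2.1.symm))
  simp only [diffZ, nbr_union]
  omega

lemma IsBipartition.inter_union_inter (h : IsBipartition G A B) (S : Finset V) :
    S ∩ A ∪ S ∩ B = S := by
  rw [← inter_union_distrib_left, h.2.2.2.1, inter_univ]

/-- In a bipartite graph, `α(G) = |B| + δ₀(A)`. -/
lemma IsBipartition.indepNum_eq (h : IsBipartition G A B) :
    (indepNum G : ℤ) = B.card + delta0 G A := by
  apply le_antisymm
  · obtain ⟨S, hS, hcard⟩ := exists_mem_eq_sup
      ((univ : Finset V).powerset.filter (IsIndep G)) ⟨∅, by simp [IsIndep]⟩ card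
    have hind : IsIndep G S := (mem_filter.1 hS).2
    have hsub : S ∩ B ⊆ B \ nbr G (S ∩ A) := by
      intro v hv
      refine mem_sdiff.2 ⟨(mem_inter.1 hv).2, fun hn => ?_⟩
      obtain ⟨x, hx, hadj⟩ := mem_nbr.1 hn
      exact hind v (mem_inter.1 hv).1 x (mem_inter.1 hx).1 hadj
    have h₁ := card_le_card hsub
    have h₂ := card_sdiff_add_card_eq_card (h.nbr_subset (inter_subset_right (s₁ := S)))
    have h₃ := card_union_le (S ∩ A) (S ∩ B)
    rw [h.inter_union_inter] at h₃
    have h₄ := diffZ_le_delta0 (G := G) (inter_subset_right (s₁ := S) (s₂ := A))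
    simp only [diffZ] at h₄
    rw [indepNum, hcard]
    omega
  · obtain ⟨X, hX, hd⟩ := exists_sideCrit G A
    have hind : IsIndep G (X ∪ B \ nbr G X) :=
      h.isIndep_union hX sdiff_subset sdiff_disjoint
    have h₁ : (X ∪ B \ nbr G X).card ≤ indepNum G :=
      le_sup (f := card) (mem_filter.2 ⟨by simp, hind⟩)
    rw [card_union_of_disjoint (disjoint_of_subset_left hX
      (disjoint_of_subset_right sdiff_subset h.2.2.1))] at h₁
    have h₂ := card_sdiff_add_card_eq_card (h.nbr_subset hX)
    rw [← hd, diffZ]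
    omega

/-- If `X` is `A`-critical, then `B \ N(X)` is `B`-critical. -/
lemma IsBipartition.sideCrit_sdiff_nbr (h : IsBipartition G A B) (hX : SideCrit G A X) :
    SideCrit G B (B \ nbr G X) := by
  refine ⟨sdiff_subset, le_antisymm (diffZ_le_delta0 sdiff_subset) ?_⟩
  have h₁ := h.indepNum_eq
  have h₂ := h.symm.indepNum_eq
  have h₃ := hX.2
  have hsub : nbr G (B \ nbr G X) ⊆ A \ X :=
    nbr_sdiff_nbr_subset.trans (sdiff_subset_sdiff (h.symm.nbr_subset subset_rfl) subset_rfl)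
  have h₄ := card_le_card hsub
  have h₅ := card_sdiff_add_card_eq_card hX.1
  have h₆ := card_sdiff_add_card_eq_card (h.nbr_subset hX.1)
  simp only [diffZ] at h₃ ⊢
  omega

lemma IsBipartition.diademSide_eq (h : IsBipartition G A B) :
    diademSide G B = B \ nbr G (kerSide G A) := by
  ext v
  refine ⟨fun hv => ?_, fun hv =>
    mem_filter.2 ⟨mem_univ v, _, h.sideCrit_sdiff_nbr (sideCrit_kerSide G A), hv⟩⟩
  obtain ⟨Y, hY, hvY⟩ := (mem_filter.1 hv).2
  refine mem_sdiff.2 ⟨hY.1 hvY, fun hn => ?_⟩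
  obtain ⟨x, hx, hadj⟩ := mem_nbr.1 hn
  have hx' := kerSide_subset ((sideCrit_kerSide G A).sdiff_nbr hY) hx
  exact (mem_sdiff.1 hx').2 (mem_nbr.2 ⟨v, hvY, hadj.symm⟩)

lemma IsBipartition.card_kerSide_add_card_diademSide (h : IsBipartition G A B) :
    (kerSide G A).card + (diademSide G B).card = indepNum G := by
  have hker := sideCrit_kerSide G A
  have h₁ := h.indepNum_eq
  have h₂ := hker.2
  have h₃ := card_sdiff_add_card_eq_card (h.nbr_subset hker.1)
  rw [h.diademSide_eq]
  simp only [diffZ] at h₂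
  omega

lemma diffZ_le_idc (hS : IsIndep G S) : diffZ G S ≤ idc G :=
  le_sup' (diffZ G) (mem_filter.2 ⟨by simp, hS⟩)

lemma IsBipartition.diffZ_le_delta0_add (h : IsBipartition G A B) (S : Finset V) :
    diffZ G S ≤ delta0 G A + delta0 G B := by
  rw [← h.inter_union_inter S, h.diffZ_union inter_subset_right inter_subset_right]
  exact add_le_add (diffZ_le_delta0 inter_subset_right) (diffZ_le_delta0 inter_subset_right)

/-- Every `A`-critical set extends to an independent set of difference `δ₀(A) + δ₀(B)`. -/
lemma IsBipartition.exists_isIndep_of_sideCrit (h : IsBipartition G A B)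
    (hX : SideCrit G A X) :
    ∃ S, X ⊆ S ∧ IsIndep G S ∧ diffZ G S = delta0 G A + delta0 G B := by
  have hY := h.sideCrit_sdiff_nbr hX
  refine ⟨X ∪ B \ nbr G X, subset_union_left, h.isIndep_union hX.1 hY.1 sdiff_disjoint, ?_⟩
  rw [h.diffZ_union hX.1 hY.1, hX.2, hY.2]

lemma IsBipartition.idc_eq (h : IsBipartition G A B) :
    idc G = delta0 G A + delta0 G B := by
  apply le_antisymm
  · exact sup'_le _ _ fun S _ => h.diffZ_le_delta0_add S
  · obtain ⟨X, hX⟩ := exists_sideCrit G A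
    obtain ⟨S, -, hS, hd⟩ := h.exists_isIndep_of_sideCrit hX
    exact hd ▸ diffZ_le_idc hS

lemma IsBipartition.diademSide_subset_diademSet (h : IsBipartition G A B) :
    diademSide G A ⊆ diademSet G := by
  intro v hv
  obtain ⟨X, hX, hvX⟩ := (mem_filter.1 hv).2
  obtain ⟨S, hXS, hS, hd⟩ := h.exists_isIndep_of_sideCrit hX
  exact mem_filter.2 ⟨mem_univ v, S, ⟨hS, hd.trans h.idc_eq.symm⟩, hXS hvX⟩

lemma IsBipartition.sideCrit_inter (h : IsBipartition G A B) (hS : CritIndep G S) :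
    SideCrit G A (S ∩ A) := by
  refine ⟨inter_subset_right, le_antisymm (diffZ_le_delta0 inter_subset_right) ?_⟩
  have h₁ := hS.2
  rw [h.idc_eq, ← h.inter_union_inter S,
    h.diffZ_union inter_subset_right inter_subset_right] at h₁
  have h₂ := diffZ_le_delta0 (G := G) (inter_subset_right (s₁ := S) (s₂ := B))
  linarith

lemma IsBipartition.diademSide_union (h : IsBipartition G A B) :
    diademSide G A ∪ diademSide G B = diademSet G := by
  refine (union_subset h.diademSide_subset_diademSet
    h.symm.diademSide_subset_diademSet).antisymm fun v hv => ?_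
  obtain ⟨S, hS, hvS⟩ := (mem_filter.1 hv).2
  rw [← h.inter_union_inter S] at hvS
  rcases mem_union.1 hvS with hv' | hv'
  · exact mem_union_left _ (mem_filter.2 ⟨mem_univ v, _, h.sideCrit_inter hS, hv'⟩)
  · exact mem_union_right _ (mem_filter.2 ⟨mem_univ v, _, h.symm.sideCrit_inter hS, hv'⟩)

end Bipartite

/-- For every finite bipartite graph:
`|ker_A(G)| + |diadem_B(G)| = |ker_B(G)| + |diadem_A(G)| = α(G)` and
`diadem_A(G) ∪ diadem_B(G) = diadem(G)`. -/
theorem kerSide_diademSide_identities (G : SimpleGraph V) (A B : Finset V)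
    (hbip : IsBipartition G A B) :
    (kerSide G A).card + (diademSide G B).card = indepNum G ∧
    (kerSide G B).card + (diademSide G A).card = indepNum G ∧
    diademSide G A ∪ diademSide G B = diademSet G := by
  exact ⟨hbip.card_kerSide_add_card_diademSide, hbip.symm.card_kerSide_add_card_diademSide,
    hbip.diademSide_union⟩
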